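/- Let 𝒳 ⊆ ℝ^{m×n} be convex, let ℓ : ℝ^{m×n} → ℝ be continuously differentiable with ∇ℓ being L_ℓ-Lipschitz on 𝒳 (in Frobenius norm), and let g : ℝ^{m×n} → ℝ be L_g-weakly convex on 𝒳; set L := L_ℓ + L_g and f := ℓ + g. Then for every Y ∈ S^n and every ρ ≥ 0, the function X ↦ ℒ_ρ(X,Y) := f(X) + ⟨Y, XᵀX − Iₙ⟩ + (ρ/2)‖XᵀX − Iₙ‖_F² is (L + 2‖Y‖ + 2ρ)-weakly convex on 𝒳, where ‖Y‖ is the spectral norm; i.e., X ↦ ℒ_ρ(X,Y) + ((L + 2‖Y‖ + 2ρ)/2)‖X‖_F² is convex on 𝒳. -/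

import Mathlib

open Matrix

noncomputable section

/-- Frobenius inner product `⟨A,B⟩ = tr(AᵀB)`. -/
def frobInner {m n : ℕ} (A B : Matrix (Fin m) (Fin n) ℝ) : ℝ := (Aᵀ * B).trace

/-- Frobenius norm. -/
def frobNorm {m n : ℕ} (A : Matrix (Fin m) (Fin n) ℝ) : ℝ := Real.sqrt (frobInner A A)

/-- Spectral (operator) norm of a matrix. -/
def specNorm {m n : ℕ} (A : Matrix (Fin m) (Fin n) ℝ) : ℝ :=
  ‖LinearMap.toContinuousLinearMap (Matrix.toEuclideanLin A)‖

/-- `gradl` is the (Fréchet) gradient of `ℓ` w.r.t. the Frobenius inner product. -/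
def IsGradientOf {m n : ℕ} (gradl : Matrix (Fin m) (Fin n) ℝ → Matrix (Fin m) (Fin n) ℝ)
    (ℓ : Matrix (Fin m) (Fin n) ℝ → ℝ) : Prop :=
  ∀ X : Matrix (Fin m) (Fin n) ℝ, ∀ c : ℝ, 0 < c → ∃ δ : ℝ, 0 < δ ∧
    ∀ H : Matrix (Fin m) (Fin n) ℝ, frobNorm H ≤ δ →
      |ℓ (X + H) - ℓ X - frobInner (gradl X) H| ≤ c * frobNorm H

section FrobeniusInner

variable {m n k : ℕ}

lemma frobInner_eq_sum (A B : Matrix (Fin m) (Fin n) ℝ) :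
    frobInner A B = ∑ p : Fin m × Fin n, A p.1 p.2 * B p.1 p.2 := by
  rw [Fintype.sum_prod_type, Finset.sum_comm]
  simp [frobInner, Matrix.trace, Matrix.mul_apply]

lemma frobInner_add_left (A B C : Matrix (Fin m) (Fin n) ℝ) :
    frobInner (A + B) C = frobInner A C + frobInner B C := by
  simp [frobInner, Matrix.add_mul]

lemma frobInner_sub_left (A B C : Matrix (Fin m) (Fin n) ℝ) :
    frobInner (A - B) C = frobInner A C - frobInner B C := by
  simp [frobInner, Matrix.sub_mul]

lemma frobInner_smul_left (c : ℝ) (A B : Matrix (Fin m) (Fin n) ℝ) :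
    frobInner (c • A) B = c * frobInner A B := by
  simp [frobInner]

lemma frobInner_comm (A B : Matrix (Fin m) (Fin n) ℝ) : frobInner A B = frobInner B A := by
  simp only [frobInner_eq_sum, mul_comm]

lemma frobInner_add_right (A B C : Matrix (Fin m) (Fin n) ℝ) :
    frobInner A (B + C) = frobInner A B + frobInner A C := by
  simp [frobInner, Matrix.mul_add]

lemma frobInner_sub_right (A B C : Matrix (Fin m) (Fin n) ℝ) :
    frobInner A (B - C) = frobInner A B - frobInner A C := by
  simp [frobInner, Matrix.mul_sub]

lemma frobInner_smul_right (c : ℝ) (A B : Matrix (Fin m) (Fin n) ℝ) :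
    frobInner A (c • B) = c * frobInner A B := by
  simp [frobInner]

lemma frobInner_self_nonneg (A : Matrix (Fin m) (Fin n) ℝ) : 0 ≤ frobInner A A := by
  rw [frobInner_eq_sum]
  exact Finset.sum_nonneg fun p _ => mul_self_nonneg _

lemma frobNorm_sq (A : Matrix (Fin m) (Fin n) ℝ) : frobNorm A ^ 2 = frobInner A A :=
  Real.sq_sqrt (frobInner_self_nonneg A)

lemma frobNorm_nonneg (A : Matrix (Fin m) (Fin n) ℝ) : 0 ≤ frobNorm A := Real.sqrt_nonneg _

lemma frobNorm_smul (c : ℝ) (A : Matrix (Fin m) (Fin n) ℝ) :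
    frobNorm (c • A) = |c| * frobNorm A := by
  rw [frobNorm, frobInner_smul_left, frobInner_smul_right, ← mul_assoc,
    Real.sqrt_mul (mul_self_nonneg c), Real.sqrt_mul_self_eq_abs, frobNorm]

lemma abs_frobInner_le (A B : Matrix (Fin m) (Fin n) ℝ) :
    |frobInner A B| ≤ frobNorm A * frobNorm B := by
  refine abs_le_of_sq_le_sq ?_ (mul_nonneg (frobNorm_nonneg A) (frobNorm_nonneg B))
  rw [mul_pow, frobNorm_sq, frobNorm_sq]
  simp only [frobInner_eq_sum, ← pow_two]
  exact Finset.sum_mul_sq_le_sq_mul_sq _ _ _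

lemma frobInner_gram_gram_nonneg (A : Matrix (Fin m) (Fin n) ℝ) (B : Matrix (Fin k) (Fin n) ℝ) :
    0 ≤ frobInner (Aᵀ * A) (Bᵀ * B) := by
  have h : frobInner (Aᵀ * A) (Bᵀ * B) = frobInner (A * Bᵀ) (A * Bᵀ) := by
    simp only [frobInner, Matrix.transpose_mul, Matrix.transpose_transpose]
    rw [← Matrix.mul_assoc, Matrix.trace_mul_comm]
    simp only [Matrix.mul_assoc]
  rw [h]
  exact frobInner_self_nonneg _

lemma frobInner_one_gram (A : Matrix (Fin m) (Fin n) ℝ) :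
    frobInner (1 : Matrix (Fin n) (Fin n) ℝ) (Aᵀ * A) = frobInner A A := by
  simp [frobInner]

/-- The Gram matrix of a convex combination. -/
lemma gram_convex_combination {a b : ℝ} (hab : a + b = 1) (U V : Matrix (Fin m) (Fin n) ℝ) :
    a • (Uᵀ * U) + b • (Vᵀ * V) =
      (a • U + b • V)ᵀ * (a • U + b • V) + (a * b) • ((U - V)ᵀ * (U - V)) := by
  obtain rfl : b = 1 - a := by linarith
  simp only [Matrix.transpose_add, Matrix.transpose_sub, Matrix.transpose_smul, Matrix.add_mul,
    Matrix.mul_add, Matrix.sub_mul, Matrix.mul_sub, Matrix.smul_mul, Matrix.mul_smul]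
  module

lemma frobInner_gram_eq_sum (Y : Matrix (Fin n) (Fin n) ℝ) (X : Matrix (Fin m) (Fin n) ℝ) :
    frobInner Y (Xᵀ * X) = ∑ i, X i ⬝ᵥ (Y *ᵥ X i) := by
  have h : frobInner Y (Xᵀ * X) = (X * Y * Xᵀ).trace := by
    rw [frobInner_comm, frobInner, Matrix.transpose_mul, Matrix.transpose_transpose,
      Matrix.mul_assoc, Matrix.trace_mul_comm]
  rw [h]
  simp only [Matrix.trace, Matrix.diag_apply, Matrix.mul_assoc]
  rfl

lemma abs_dotProduct_mulVec_le (Y : Matrix (Fin n) (Fin n) ℝ) (v : Fin n → ℝ) :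
    |v ⬝ᵥ (Y *ᵥ v)| ≤ specNorm Y * (v ⬝ᵥ v) := by
  set x : EuclideanSpace ℝ (Fin n) := WithLp.toLp 2 v with hx
  set T := LinearMap.toContinuousLinearMap (Matrix.toEuclideanLin Y) with hT
  have h1 : v ⬝ᵥ (Y *ᵥ v) = inner ℝ x (T x) := by
    simp [hx, hT, EuclideanSpace.inner_eq_star_dotProduct, dotProduct_comm,
      Matrix.toLpLin_apply]
  have h2 : v ⬝ᵥ v = ‖x‖ * ‖x‖ := by
    rw [← real_inner_self_eq_norm_mul_norm, EuclideanSpace.inner_eq_star_dotProduct]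
    simp [hx]
  rw [h1, h2]
  calc |inner ℝ x (T x)| ≤ ‖x‖ * ‖T x‖ := abs_real_inner_le_norm _ _
    _ ≤ ‖x‖ * (‖T‖ * ‖x‖) := by gcongr; exact T.le_opNorm x
    _ = specNorm Y * (‖x‖ * ‖x‖) := by rw [specNorm]; ring

lemma frobInner_gram_add_specNorm_nonneg (Y : Matrix (Fin n) (Fin n) ℝ)
    (X : Matrix (Fin m) (Fin n) ℝ) :
    0 ≤ frobInner Y (Xᵀ * X) + specNorm Y * frobInner X X := by
  have h : frobInner X X = ∑ i, X i ⬝ᵥ X i := by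
    rw [frobInner_eq_sum, Fintype.sum_prod_type]
    rfl
  rw [h, frobInner_gram_eq_sum, Finset.mul_sum, ← Finset.sum_add_distrib]
  exact Finset.sum_nonneg fun i _ => by
    linarith [neg_abs_le (X i ⬝ᵥ (Y *ᵥ X i)), abs_dotProduct_mulVec_le Y (X i)]

end FrobeniusInner

section Convexity

variable {m n : ℕ} {s : Set (Matrix (Fin m) (Fin n) ℝ)}

lemma convexOn_frobInner_gram (hs : Convex ℝ s) (Y : Matrix (Fin n) (Fin n) ℝ) :
    ConvexOn ℝ s fun X => frobInner Y (Xᵀ * X - 1) + specNorm Y * frobNorm X ^ 2 := by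
  refine ⟨hs, fun U _ V _ a b ha hb hab => ?_⟩
  have h1 := congrArg (frobInner Y) (gram_convex_combination hab U V)
  have h2 := congrArg (frobInner 1) (gram_convex_combination hab U V)
  have h3 := mul_nonneg (mul_nonneg ha hb) (frobInner_gram_add_specNorm_nonneg Y (U - V))
  set W := a • U + b • V
  simp only [frobInner_add_right, frobInner_smul_right, frobInner_one_gram] at h1 h2
  simp only [frobNorm_sq, frobInner_sub_right Y _ 1, smul_eq_mul]
  obtain rfl : b = 1 - a := by linarith
  linear_combination h3 - h1 - specNorm Y * h2

lemma convexOn_frobNorm_gram_sq (hs : Convex ℝ s) :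
    ConvexOn ℝ s fun X => frobNorm (Xᵀ * X - 1) ^ 2 + 2 * frobNorm X ^ 2 := by
  have key : ∀ X : Matrix (Fin m) (Fin n) ℝ, frobNorm (Xᵀ * X - 1) ^ 2 + 2 * frobNorm X ^ 2 =
      frobInner (Xᵀ * X) (Xᵀ * X) + frobInner (1 : Matrix (Fin n) (Fin n) ℝ) 1 := by
    intro X
    rw [frobNorm_sq, frobNorm_sq]
    simp only [frobInner_sub_left, frobInner_sub_right, frobInner_comm (Xᵀ * X) 1,
      frobInner_one_gram]
    ring
  simp only [key]
  refine ⟨hs, fun U _ V _ a b ha hb hab => ?_⟩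
  have hc := gram_convex_combination hab U V
  set P := (a • U + b • V)ᵀ * (a • U + b • V) with hP
  have h1 : frobInner P P ≤
      frobInner (a • (Uᵀ * U) + b • (Vᵀ * V)) (a • (Uᵀ * U) + b • (Vᵀ * V)) := by
    rw [hc]
    have h2 := mul_nonneg (mul_nonneg ha hb)
      (frobInner_gram_gram_nonneg (a • U + b • V) (U - V))
    have h3 := frobInner_self_nonneg ((a * b) • ((U - V)ᵀ * (U - V)))
    rw [← hP] at h2
    simp only [frobInner_add_left, frobInner_add_right]
    rw [frobInner_comm ((a * b) • _) P, frobInner_smul_right _ P]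
    linarith
  have h2 := mul_nonneg (mul_nonneg ha hb) (frobInner_self_nonneg (Uᵀ * U - Vᵀ * V))
  simp only [frobInner_add_left, frobInner_add_right, frobInner_sub_left, frobInner_sub_right,
    frobInner_smul_left, frobInner_smul_right, frobInner_comm (Vᵀ * V) (Uᵀ * U)] at h1 h2
  simp only [smul_eq_mul]
  obtain rfl : b = 1 - a := by linarith
  linear_combination h1 + h2

lemma IsGradientOf.hasDerivAt_comp_line
    {gradl : Matrix (Fin m) (Fin n) ℝ → Matrix (Fin m) (Fin n) ℝ}
    {ℓ : Matrix (Fin m) (Fin n) ℝ → ℝ} (h : IsGradientOf gradl ℓ)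
    (V D : Matrix (Fin m) (Fin n) ℝ) (t : ℝ) :
    HasDerivAt (fun r : ℝ => ℓ (V + r • D)) (frobInner (gradl (V + t • D)) D) t := by
  rw [hasDerivAt_iff_isLittleO_nhds_zero, Asymptotics.isLittleO_iff]
  intro c hc
  have hd : 0 < frobNorm D + 1 := by linarith [frobNorm_nonneg D]
  obtain ⟨δ, hδ, hb⟩ := h (V + t • D) (c / (frobNorm D + 1)) (div_pos hc hd)
  filter_upwards [Metric.ball_mem_nhds (0 : ℝ) (div_pos hδ hd)] with r hr
  rw [mem_ball_zero_iff, Real.norm_eq_abs, lt_div_iff₀ hd] at hr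
  have hle : frobNorm (r • D) ≤ |r| * (frobNorm D + 1) := by
    rw [frobNorm_smul]
    nlinarith [abs_nonneg r]
  have h1 := hb (r • D) (by linarith)
  rw [frobInner_smul_right, add_assoc, ← add_smul] at h1
  rw [Real.norm_eq_abs, Real.norm_eq_abs, smul_eq_mul]
  calc _ ≤ c / (frobNorm D + 1) * frobNorm (r • D) := h1
    _ ≤ c / (frobNorm D + 1) * (|r| * (frobNorm D + 1)) := by gcongr
    _ = c * |r| := by field_simp

lemma IsGradientOf.convexOn_add_frobNorm_sq
    {gradl : Matrix (Fin m) (Fin n) ℝ → Matrix (Fin m) (Fin n) ℝ}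
    {ℓ : Matrix (Fin m) (Fin n) ℝ → ℝ} (h : IsGradientOf gradl ℓ) (hs : Convex ℝ s) {L : ℝ}
    (hL : ∀ X ∈ s, ∀ X' ∈ s, frobNorm (gradl X - gradl X') ≤ L * frobNorm (X - X')) :
    ConvexOn ℝ s fun X => ℓ X + L / 2 * frobNorm X ^ 2 := by
  refine ⟨hs, fun U hU V hV a b ha hb hab => ?_⟩
  set D := U - V with hD
  have hquad : ∀ r : ℝ, frobNorm (V + r • D) ^ 2 =
      frobInner V V + 2 * r * frobInner V D + r ^ 2 * frobInner D D := by
    intro r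
    rw [frobNorm_sq]
    simp only [frobInner_add_left, frobInner_add_right, frobInner_smul_left,
      frobInner_smul_right, frobInner_comm D V]
    ring
  have hderiv : ∀ t : ℝ, HasDerivAt (fun r : ℝ => ℓ (V + r • D) + L / 2 * frobNorm (V + r • D) ^ 2)
      (frobInner (gradl (V + t • D)) D + L * (frobInner V D + t * frobInner D D)) t := by
    intro t
    simp only [hquad]
    have h1 : HasDerivAt (fun r : ℝ => L / 2 *
        (frobInner V V + 2 * r * frobInner V D + r ^ 2 * frobInner D D))
        (L / 2 * (2 * 1 * frobInner V D + 2 * t * frobInner D D)) t := by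
      refine HasDerivAt.const_mul _ (HasDerivAt.add (HasDerivAt.const_add _
        (((hasDerivAt_id t).const_mul 2).mul_const _)) ?_)
      simpa using (hasDerivAt_pow 2 t).mul_const (frobInner D D)
    refine ((h.hasDerivAt_comp_line V D t).add h1).congr_deriv ?_
    ring
  have hmem : ∀ t ∈ Set.Icc (0 : ℝ) 1, V + t • D ∈ s := fun t ht =>
    hs.add_smul_sub_mem hV hU ht
  have hconv : ConvexOn ℝ (Set.Icc (0 : ℝ) 1)
      fun r : ℝ => ℓ (V + r • D) + L / 2 * frobNorm (V + r • D) ^ 2 := by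
    refine MonotoneOn.convexOn_of_deriv (convex_Icc 0 1)
      (fun t _ => (hderiv t).continuousAt.continuousWithinAt)
      (fun t _ => (hderiv t).differentiableAt.differentiableWithinAt) ?_
    intro p hp q hq hpq
    rw [(hderiv p).deriv, (hderiv q).deriv]
    have hlip := hL _ (hmem q (interior_subset hq)) _ (hmem p (interior_subset hp))
    have hsub : V + q • D - (V + p • D) = (q - p) • D := by module
    rw [hsub, frobNorm_smul, abs_of_nonneg (sub_nonneg.2 hpq)] at hlip
    have hcs := (abs_le.1 (abs_frobInner_le (gradl (V + q • D) - gradl (V + p • D)) D)).1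
    rw [frobInner_sub_left] at hcs
    have hmul := mul_le_mul_of_nonneg_right hlip (frobNorm_nonneg D)
    have hsq := frobNorm_sq D
    linear_combination hcs + hmul + L * (q - p) * hsq
  have h1 := hconv.2 (Set.right_mem_Icc.2 zero_le_one) (Set.left_mem_Icc.2 zero_le_one) ha hb hab
  have e1 : V + (1 : ℝ) • D = U := by rw [hD]; module
  have e2 : V + (0 : ℝ) • D = V := by module
  have e3 : V + a • D = a • U + b • V := by
    obtain rfl : b = 1 - a := by linarith
    rw [hD]; module
  simpa only [smul_eq_mul, mul_one, mul_zero, add_zero, e1, e2, e3] using h1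

end Convexity

/-- The augmented Lagrangian `ℒ_ρ(·,Y)` is `(L + 2‖Y‖ + 2ρ)`-weakly convex on `𝒳`. -/
theorem augmented_Lagrangian_weakly_convex {m n : ℕ} (hmn : n ≤ m)
    (𝒳 : Set (Matrix (Fin m) (Fin n) ℝ)) (h𝒳conv : Convex ℝ 𝒳)
    (ℓ g : Matrix (Fin m) (Fin n) ℝ → ℝ)
    (gradl : Matrix (Fin m) (Fin n) ℝ → Matrix (Fin m) (Fin n) ℝ)
    (Lℓ Lg : ℝ)
    (hgrad : IsGradientOf gradl ℓ) (hgradcont : Continuous gradl)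
    (hgradLip : ∀ X ∈ 𝒳, ∀ X' ∈ 𝒳, frobNorm (gradl X - gradl X') ≤ Lℓ * frobNorm (X - X'))
    (hgwc : ConvexOn ℝ 𝒳 (fun X => g X + Lg / 2 * frobNorm X ^ 2))
    (Y : Matrix (Fin n) (Fin n) ℝ) (hY : Y.IsSymm) (ρ : ℝ) (hρ : 0 ≤ ρ) :
    ConvexOn ℝ 𝒳 (fun X =>
      (ℓ X + g X + frobInner Y (Xᵀ * X - 1) + ρ / 2 * frobNorm (Xᵀ * X - 1) ^ 2)
        + ((Lℓ + Lg) + 2 * specNorm Y + 2 * ρ) / 2 * frobNorm X ^ 2) := by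
  have hsum := (((hgrad.convexOn_add_frobNorm_sq h𝒳conv hgradLip).add hgwc).add
    (convexOn_frobInner_gram h𝒳conv Y)).add
    ((convexOn_frobNorm_gram_sq h𝒳conv).smul (div_nonneg hρ zero_le_two))
  refine hsum.congr fun X _ => ?_
  simp only [Pi.add_apply, smul_eq_mul]
  ring

end
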